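/- Assume {Ω_1,…,Ω_d} is a Lipschitz partition of Ω. Then there exists a constant C_0 depending only on the geometry of the partition (through the Poincaré constants C_P and the norms C_E of the H^1 extension operators associated to unions of subdomains) such that for every S ⊂ {1,…,d} and every y = (y_S, y_{S^c}) ∈ [1,∞)^d one has ‖u(y) − u_S(y_{S^c})‖_{H^1_0} ≤ C_0 C_f max_{j∈S} y_j^{-1}. -/

import Mathlib

open scoped BigOperators ENNReal InnerProductSpace
open Filter

noncomputable section

variable {V : Type*} [NormedAddCommGroup V] [InnerProductSpace ℝ V] [CompleteSpace V]

/-- The closed subspace `V_S` of functions whose gradient vanishes on `Ω_j` for all `j ∈ S`,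
encoded through the local Dirichlet forms `B j v w = ∫_{Ω_j} ∇v·∇w`. -/
def VS {d : ℕ} (B : Fin d → V →L[ℝ] V →L[ℝ] ℝ) (S : Set (Fin d)) : Submodule ℝ V where
  carrier := {v | ∀ j ∈ S, B j v = 0}
  add_mem' := by
    intro a b ha hb j hj
    simp only [Set.mem_setOf_eq] at *
    simp [map_add, ha j hj, hb j hj]
  zero_mem' := by intro j hj; simp
  smul_mem' := by
    intro c a ha j hj
    simp only [Set.mem_setOf_eq] at *
    simp [map_smul, ha j hj]

/-- The parametric energy bilinear form `a_y(v,w) = Σ_j y_j ∫_{Ω_j} ∇v·∇w`. -/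
def aForm {d : ℕ} (B : Fin d → V →L[ℝ] V →L[ℝ] ℝ) (y : Fin d → ℝ) (v w : V) : ℝ :=
  ∑ j, y j * B j v w

/-- The parametric energy norm `‖v‖_y`. -/
def eNorm {d : ℕ} (B : Fin d → V →L[ℝ] V →L[ℝ] ℝ) (y : Fin d → ℝ) (v : V) : ℝ :=
  Real.sqrt (aForm B y v v)

/-- `u` is the weak solution of the diffusion problem with (finite) parameter `y`. -/
def IsWeakSol {d : ℕ} (B : Fin d → V →L[ℝ] V →L[ℝ] ℝ) (f : V →L[ℝ] ℝ)
    (y : Fin d → ℝ) (u : V) : Prop :=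
  ∀ v : V, aForm B y u v = f v

/-- `u` is the (possibly stiff-limit) solution for an extended parameter `y ∈ (0,∞]^d`:
on the set `S = {j | y j = ∞}` of infinite entries, `u ∈ V_S` and `u` solves the
limit variational problem over `V_S`. -/
def IsSolE {d : ℕ} (B : Fin d → V →L[ℝ] V →L[ℝ] ℝ) (f : V →L[ℝ] ℝ)
    (y : Fin d → ℝ≥0∞) (u : V) : Prop :=
  u ∈ VS B {j | y j = ∞} ∧
  ∀ v ∈ VS B {j | y j = ∞}, ∑ j, (y j).toReal * B j u v = f v

/-- `p` is the `H^1_0`-orthogonal projection of `u` onto `K`. -/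
def IsOrthProj (K : Submodule ℝ V) (u p : V) : Prop :=
  p ∈ K ∧ ∀ w ∈ K, ⟪u - p, w⟫_ℝ = 0

/-- `p` is the Galerkin projection of `u` onto `K` for the energy inner product `⟨·,·⟩_y`. -/
def IsGalProj {d : ℕ} (B : Fin d → V →L[ℝ] V →L[ℝ] ℝ) (y : Fin d → ℝ)
    (K : Submodule ℝ V) (u p : V) : Prop :=
  p ∈ K ∧ ∀ w ∈ K, aForm B y (u - p) w = 0

/-- Galerkin projection for an extended parameter `y ∈ (0,∞]^d` (the energy inner
product being restricted to the finite components of `y`). -/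
def IsGalProjE {d : ℕ} (B : Fin d → V →L[ℝ] V →L[ℝ] ℝ) (y : Fin d → ℝ≥0∞)
    (K : Submodule ℝ V) (u p : V) : Prop :=
  p ∈ K ∧ ∀ w ∈ K, ∑ j, (y j).toReal * B j (u - p) w = 0

/-- The finite set of multi-indices `ν ∈ ℕ^d` of total degree `|ν| ≤ k`. -/
def mIdx (d k : ℕ) : Finset (Fin d → ℕ) :=
  (Fintype.piFinset fun _ : Fin d => Finset.range (k+1)).filter fun ν => ∑ j, ν j ≤ k

/-- The monomial `y^ν`. -/
def mono {d : ℕ} (y : Fin d → ℝ) (ν : Fin d → ℕ) : ℝ := ∏ j, y j ^ ν j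

theorem step_aux
    {V : Type*} [NormedAddCommGroup V] [InnerProductSpace ℝ V]
    {d : ℕ}
    (B : Fin d → V →L[ℝ] V →L[ℝ] ℝ)
    (hsymm : ∀ (j : Fin d) (v w : V), B j v w = B j w v)
    (hnonneg : ∀ (j : Fin d) (v : V), 0 ≤ B j v v)
    (hsum : ∀ v w : V, ∑ j, B j v w = ⟪v, w⟫_ℝ)
    (CPE : ℝ)
    (hext : ∀ (T : Finset (Fin d)) (g : V), ∃ w : V,
      g - w ∈ VS B ↑T ∧ ‖w‖ ≤ CPE * Real.sqrt (∑ j ∈ T, B j g g))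
    (S : Finset (Fin d)) (y : Fin d → ℝ) (hy : ∀ j, 1 ≤ y j) (e : V)
    (he : ∀ z ∈ VS B ↑S, ∑ j, y j * B j e z = 0) :
    ∀ (n : ℕ) (T : Finset (Fin d)), S ⊆ T → Tᶜ.card = n →
      ‖e‖ ^ 2 ≤ (1 + CPE ^ 2) ^ n * ∑ j ∈ T, B j e e := by
  intro n
  induction n with
  | zero =>
    intro T _ hc
    have : T = Finset.univ := by
      simpa using hc
    rw [this, hsum, real_inner_self_eq_norm_sq]; simp
  | succ n ih =>
    intro T hST hc
    have hne : (Tᶜ).Nonempty := by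
      rw [← Finset.card_pos]; omega
    obtain ⟨j, hj, hmax⟩ := Finset.exists_max_image Tᶜ y hne
    have hjT : j ∉ T := by simpa using hj
    have h1 := ih (insert j T) (hST.trans (Finset.subset_insert _ _)) (by
      rw [Finset.card_compl, Finset.card_insert_of_notMem hjT]
      rw [Finset.card_compl] at hc; omega)
    rw [Finset.sum_insert hjT] at h1
    obtain ⟨w, hw, hwn⟩ := hext T e
    have hA : 0 ≤ ∑ j ∈ T, B j e e := Finset.sum_nonneg fun i _ => hnonneg i e
    have hw2 : ‖w‖ ^ 2 ≤ CPE ^ 2 * ∑ j ∈ T, B j e e := by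
      calc ‖w‖ ^ 2 ≤ (CPE * Real.sqrt (∑ j ∈ T, B j e e)) ^ 2 :=
            pow_le_pow_left₀ (norm_nonneg _) hwn 2
        _ = _ := by rw [mul_pow, Real.sq_sqrt hA]
    have hyj : 0 < y j := lt_of_lt_of_le one_pos (hy j)
    have hz := he (e - w) (fun i hi => hw i (by exact_mod_cast hST (by exact_mod_cast hi)))
    rw [← Finset.sum_add_sum_compl T] at hz
    have hzT : ∑ i ∈ T, y i * B i e (e - w) = 0 :=
      Finset.sum_eq_zero fun i hi => by
        rw [hsymm, hw i (by exact_mod_cast hi)]; simp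
    rw [hzT, zero_add] at hz
    have hkey : ∑ i ∈ Tᶜ, y i * B i e e ≤ ∑ i ∈ Tᶜ, y i * B i w w := by
      have : ∑ i ∈ Tᶜ, y i * B i w w = ∑ i ∈ Tᶜ, y i * B i e e
          - 2 * ∑ i ∈ Tᶜ, y i * B i e (e - w) + ∑ i ∈ Tᶜ, y i * B i (e - w) (e - w) := by
        rw [Finset.mul_sum, ← Finset.sum_sub_distrib, ← Finset.sum_add_distrib]
        refine Finset.sum_congr rfl fun i _ => ?_
        simp only [map_sub, ContinuousLinearMap.sub_apply, hsymm i w e]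
        ring
      rw [this, hz]
      have : 0 ≤ ∑ i ∈ Tᶜ, y i * B i (e - w) (e - w) :=
        Finset.sum_nonneg fun i _ => mul_nonneg (zero_le_one.trans (hy i)) (hnonneg i _)
      linarith
    have hl : y j * B j e e ≤ ∑ i ∈ Tᶜ, y i * B i e e :=
      Finset.single_le_sum (f := fun i => y i * B i e e)
        (fun i _ => mul_nonneg (zero_le_one.trans (hy i)) (hnonneg i _)) hj
    have hr : ∑ i ∈ Tᶜ, y i * B i w w ≤ y j * ‖w‖ ^ 2 := by
      rw [← real_inner_self_eq_norm_sq, ← hsum, Finset.mul_sum]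
      calc ∑ i ∈ Tᶜ, y i * B i w w ≤ ∑ i ∈ Tᶜ, y j * B i w w :=
            Finset.sum_le_sum fun i hi => mul_le_mul_of_nonneg_right (hmax i hi) (hnonneg i w)
        _ ≤ _ := Finset.sum_le_sum_of_subset_of_nonneg (Finset.subset_univ _)
            fun i _ _ => mul_nonneg hyj.le (hnonneg i w)
    have hb : B j e e ≤ ‖w‖ ^ 2 := le_of_mul_le_mul_left (hl.trans (hkey.trans hr)) hyj
    calc ‖e‖ ^ 2 ≤ (1 + CPE ^ 2) ^ n * (B j e e + ∑ j ∈ T, B j e e) := h1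
      _ ≤ (1 + CPE ^ 2) ^ n * ((1 + CPE ^ 2) * ∑ j ∈ T, B j e e) := by
          apply mul_le_mul_of_nonneg_left _ (by positivity)
          linarith
      _ = _ := by ring

/-- Lemma 3.4: for a Lipschitz partition (encoded through the
Poincaré--extension property with constant `CPE`), there is a constant `C_0`, depending
only on the geometry, such that `‖u(y) − u_S(y_{S^c})‖ ≤ C_0 C_f max_{j∈S} y_j⁻¹`. -/
theorem statement8
    {V : Type*} [NormedAddCommGroup V] [InnerProductSpace ℝ V] [CompleteSpace V]
    {d : ℕ}
    (B : Fin d → V →L[ℝ] V →L[ℝ] ℝ)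
    (hsymm : ∀ (j : Fin d) (v w : V), B j v w = B j w v)
    (hnonneg : ∀ (j : Fin d) (v : V), 0 ≤ B j v v)
    (hsum : ∀ v w : V, ∑ j, B j v w = ⟪v, w⟫_ℝ)
    (CPE : ℝ)
    (hext : ∀ (T : Finset (Fin d)) (g : V), ∃ w : V,
      g - w ∈ VS B ↑T ∧ ‖w‖ ≤ CPE * Real.sqrt (∑ j ∈ T, B j g g))
 :
    ∃ C0 : ℝ, 0 < C0 ∧
      ∀ (f : V →L[ℝ] ℝ) (S : Finset (Fin d)) (hS : S.Nonempty) (y : Fin d → ℝ),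
        (∀ j, 1 ≤ y j) →
        ∀ u uS : V, IsWeakSol B f y u →
          uS ∈ VS B ↑S → (∀ v ∈ VS B ↑S, ∑ j ∈ Sᶜ, y j * B j uS v = f v) →
          ‖u - uS‖ ≤ C0 * ‖f‖ * S.sup' hS fun j => (y j)⁻¹ := by
  refine ⟨(1 + CPE ^ 2) ^ d, by positivity, ?_⟩
  intro f S hS y hy u uS hu huS hsol
  have hsol2 : ∀ v ∈ VS B ↑S, ∑ j, y j * B j (u - uS) v = 0 := by
    intro v hv
    have h1 : ∑ j, y j * B j u v = f v := hu v
    have h2 : ∑ j, y j * B j uS v = f v := by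
      rw [← Finset.sum_add_sum_compl S, hsol v hv, Finset.sum_eq_zero, zero_add]
      intro i hi
      rw [huS i (by exact_mod_cast hi)]; simp
    simp only [map_sub, ContinuousLinearMap.sub_apply, mul_sub, Finset.sum_sub_distrib]
    rw [h1, h2, sub_self]
  have hstab := step_aux B hsymm hnonneg hsum CPE hext S y hy (u - uS) hsol2 _ S
    (Finset.Subset.refl _) rfl
  have hf : ∑ j, y j * B j (u - uS) (u - uS) = f (u - uS) := by
    have h1 : ∑ j, y j * B j u (u - uS) = f (u - uS) := hu _
    have h2 : ∑ j, y j * B j uS (u - uS) = 0 := by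
      rw [← hsol2 uS huS]
      exact Finset.sum_congr rfl fun i _ => by rw [hsymm]
    have h3 : ∑ j, y j * B j (u - uS) (u - uS)
        = ∑ j, y j * B j u (u - uS) - ∑ j, y j * B j uS (u - uS) := by
      rw [← Finset.sum_sub_distrib]
      refine Finset.sum_congr rfl fun i _ => ?_
      rw [map_sub (B i), ContinuousLinearMap.sub_apply, mul_sub]
    rw [h3, h1, h2, sub_zero]
  generalize u - uS = e at *
  set M := S.sup' hS fun j => (y j)⁻¹ with hM
  have hMj : ∀ j ∈ S, (y j)⁻¹ ≤ M := fun j hj =>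
    Finset.le_sup' (fun j => (y j)⁻¹) hj
  have hM0 : 0 ≤ M := by
    obtain ⟨j, hj⟩ := hS
    exact (inv_nonneg.2 (zero_le_one.trans (hy j))).trans (hMj j hj)
  have hA : ∑ j ∈ S, B j e e ≤ M * (‖f‖ * ‖e‖) := by
    calc ∑ j ∈ S, B j e e ≤ ∑ j ∈ S, M * (y j * B j e e) := by
          refine Finset.sum_le_sum fun j hj => ?_
          have hyj : 0 < y j := lt_of_lt_of_le one_pos (hy j)
          calc B j e e = (y j)⁻¹ * (y j * B j e e) := by field_simp
            _ ≤ _ := mul_le_mul_of_nonneg_right (hMj j hj)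
              (mul_nonneg hyj.le (hnonneg j e))
      _ = M * ∑ j ∈ S, y j * B j e e := by rw [Finset.mul_sum]
      _ ≤ M * ∑ j, y j * B j e e := by
          apply mul_le_mul_of_nonneg_left _ hM0
          exact Finset.sum_le_sum_of_subset_of_nonneg (Finset.subset_univ _)
            fun i _ _ => mul_nonneg (zero_le_one.trans (hy i)) (hnonneg i e)
      _ = M * f e := by rw [hf]
      _ ≤ _ := mul_le_mul_of_nonneg_left
          ((le_abs_self _).trans (f.le_opNorm e)) hM0
  have hK : (1 + CPE ^ 2) ^ (Sᶜ.card) ≤ (1 + CPE ^ 2) ^ d :=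
    pow_le_pow_right₀ (by nlinarith [sq_nonneg CPE])
      ((Finset.card_le_univ _).trans (by simp))
  have hfin : ‖e‖ * ‖e‖ ≤ ((1 + CPE ^ 2) ^ d * ‖f‖ * M) * ‖e‖ := by
    calc ‖e‖ * ‖e‖ = ‖e‖ ^ 2 := by ring
      _ ≤ _ := hstab
      _ ≤ (1 + CPE ^ 2) ^ d * (M * (‖f‖ * ‖e‖)) :=
          mul_le_mul hK hA (Finset.sum_nonneg fun i _ => hnonneg i e) (by positivity)
      _ = _ := by ring
  rcases (norm_nonneg e).eq_or_lt with h0 | h0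
  · rw [← h0]; positivity
  · exact le_of_mul_le_mul_right hfin h0

end
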